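/- With the closed-form setup (p, K, ᾱ, θ̄, R̄, ẑ, û, u₀, q, k, G̃ as in the context), the function G̃ solves the linear backward Kolmogorov (dual HJB) equation for a geometric Brownian motion with drift −ᾱ and volatility θ̄: for every τ > 0 and y > 0, ∂_τ G̃(τ, y) = −ᾱ·y·∂_y G̃(τ, y) + (1/2)·θ̄²·y²·∂_{yy} G̃(τ, y). -/

import Mathlib

open Set Filter Topology MeasureTheory ProbabilityTheory

/-- `w` satisfies the backward Kolmogorov equation of a geometric Brownian motion with drift `-α`
and volatility `θ` at `(τ, y)`, with `w τ` differentiable on the positive half-line. -/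
def SolvesKolmogorovAt (α θ : ℝ) (w : ℝ → ℝ → ℝ) (τ y : ℝ) : Prop :=
  ∃ (w₁ : ℝ → ℝ) (w₂ : ℝ), (∀ z > 0, HasDerivAt (w τ) (w₁ z) z) ∧ HasDerivAt w₁ w₂ y ∧
    HasDerivAt (fun t => w t y) (-α * y * w₁ y + 1 / 2 * θ ^ 2 * y ^ 2 * w₂) τ

namespace SolvesKolmogorovAt

variable {α θ τ y : ℝ} {v w : ℝ → ℝ → ℝ}

theorem const_mul (hw : SolvesKolmogorovAt α θ w τ y) (C : ℝ) :
    SolvesKolmogorovAt α θ (fun t z => C * w t z) τ y := by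
  obtain ⟨w₁, w₂, h₁, h₂, h₃⟩ := hw
  refine ⟨fun z => C * w₁ z, C * w₂, fun z hz => (h₁ z hz).const_mul C, h₂.const_mul C, ?_⟩
  exact (h₃.const_mul C).congr_deriv (by ring)

theorem add (hv : SolvesKolmogorovAt α θ v τ y) (hw : SolvesKolmogorovAt α θ w τ y) :
    SolvesKolmogorovAt α θ (fun t z => v t z + w t z) τ y := by
  obtain ⟨v₁, v₂, g₁, g₂, g₃⟩ := hv
  obtain ⟨w₁, w₂, h₁, h₂, h₃⟩ := hw
  refine ⟨fun z => v₁ z + w₁ z, v₂ + w₂, fun z hz => (g₁ z hz).add (h₁ z hz), g₂.add h₂, ?_⟩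
  exact (g₃.add h₃).congr_deriv (by ring)

theorem congr (hw : SolvesKolmogorovAt α θ w τ y) (hτ : 0 < τ) (h : ∀ t > 0, v t = w t) :
    SolvesKolmogorovAt α θ v τ y := by
  obtain ⟨w₁, w₂, h₁, h₂, h₃⟩ := hw
  refine ⟨w₁, w₂, h τ hτ ▸ h₁, h₂, h₃.congr_of_eventuallyEq ?_⟩
  exact (eventually_gt_nhds hτ).mono fun t ht => congrFun (h t ht) y

theorem hasDerivAt (hw : SolvesKolmogorovAt α θ w τ y) (hy : 0 < y) :
    HasDerivAt (fun t => w t y)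
      (-α * y * deriv (w τ) y + 1 / 2 * θ ^ 2 * y ^ 2 * deriv (deriv (w τ)) y) τ := by
  obtain ⟨w₁, w₂, h₁, h₂, h₃⟩ := hw
  have h : deriv (w τ) =ᶠ[𝓝 y] w₁ :=
    (eventually_gt_nhds hy).mono fun z hz => (h₁ z hz).deriv
  rwa [(h₁ y hy).deriv, h.deriv_eq, h₂.deriv]

end SolvesKolmogorovAt

theorem hasDerivAt_integral_Iic {f : ℝ → ℝ} (hf : Continuous f) (hint : Integrable f) (x : ℝ) :
    HasDerivAt (fun x => ∫ t in Iic x, f t) (f x) x := by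
  have h : (fun x => ∫ t in Iic x, f t) = fun x => (∫ t in Iic 0, f t) + ∫ t in (0 : ℝ)..x, f t := by
    funext x
    rw [← intervalIntegral.integral_Iic_sub_Iic hint.integrableOn hint.integrableOn]
    ring
  rw [h]
  exact (intervalIntegral.integral_hasDerivAt_right (hf.intervalIntegrable _ _)
    (hf.stronglyMeasurableAtFilter _ _) hf.continuousAt).const_add _

theorem hasDerivAt_gaussian_cdf (C x : ℝ) :
    HasDerivAt (fun x => ∫ t in Iic x, C * Real.exp (-(t ^ 2) / 2))
      (C * Real.exp (-(x ^ 2) / 2)) x := by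
  refine hasDerivAt_integral_Iic (f := fun t => C * Real.exp (-(t ^ 2) / 2)) (by fun_prop) ?_ x
  refine Integrable.const_mul ?_ C
  convert integrable_exp_neg_mul_sq (b := 1 / 2) (by norm_num) using 3
  ring

theorem hasDerivAt_gaussian (C x : ℝ) :
    HasDerivAt (fun x => C * Real.exp (-(x ^ 2) / 2)) (-x * (C * Real.exp (-(x ^ 2) / 2))) x := by
  have h : HasDerivAt (fun x : ℝ => -(x ^ 2) / 2) (-x) x :=
    (((hasDerivAt_pow 2 x).neg).div_const 2).congr_deriv (by norm_num; ring)
  exact (h.exp.const_mul C).congr_deriv (by ring)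

theorem hasDerivAt_rpow_const_of_pos {z : ℝ} (hz : 0 < z) (a : ℝ) :
    HasDerivAt (fun z => z ^ a) (a * z ^ a / z) z :=
  (Real.hasDerivAt_rpow_const (Or.inl hz.ne')).congr_deriv (by
    rw [Real.rpow_sub_one hz.ne', mul_div_assoc])

/-- Power solutions of the Kolmogorov equation, multiplied by a Gaussian distribution function
evaluated at a suitably shifted and rescaled logarithm, are again solutions. -/
theorem solvesKolmogorovAt_rpow_mul_exp_mul {α θ τ y : ℝ} (hθ : 0 < θ) (hτ : 0 < τ) (hy : 0 < y)
    {Φ φ : ℝ → ℝ} (hΦ : ∀ x, HasDerivAt Φ (φ x) x) (hφ : ∀ x, HasDerivAt φ (-x * φ x) x)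
    (a l : ℝ) {s : ℝ} (hs : s ^ 2 = 1) :
    SolvesKolmogorovAt α θ (fun t z => z ^ a *
      Real.exp ((-α * a + θ ^ 2 / 2 * (a * (a - 1))) * t) *
      Φ (s * ((Real.log z - l - (α + θ ^ 2 / 2 - a * θ ^ 2) * t) / (θ * Real.sqrt t)))) τ y := by
  set b := α + θ ^ 2 / 2 - a * θ ^ 2 with hb
  set c := -α * a + θ ^ 2 / 2 * (a * (a - 1)) with hc
  have hr : 0 < Real.sqrt τ := Real.sqrt_pos.2 hτ
  have hr2 : Real.sqrt τ ^ 2 = τ := Real.sq_sqrt hτ.le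
  set d : ℝ → ℝ → ℝ := fun t z => s * ((Real.log z - l - b * t) / (θ * Real.sqrt t)) with hd
  set m := s / (θ * Real.sqrt τ) with hm
  have hdz (z : ℝ) (hz : 0 < z) : HasDerivAt (d τ) (m / z) z :=
    (((((Real.hasDerivAt_log hz.ne').sub_const l).sub_const (b * τ)).div_const
      (θ * Real.sqrt τ)).const_mul s).congr_deriv (by rw [hm]; field_simp)
  have hdt : HasDerivAt (fun t => d t y)
      (-m * b - d τ y / (2 * τ)) τ := by
    have h := ((((hasDerivAt_id τ).const_mul b).const_sub (Real.log y - l)).div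
      ((Real.hasDerivAt_sqrt hτ.ne').const_mul θ) (by positivity)).const_mul s
    refine h.congr_deriv ?_
    simp only [hd, hm, id]
    generalize Real.sqrt τ = r at hr hr2
    subst hr2
    field_simp
  refine ⟨fun z => Real.exp (c * τ) * (z ^ a / z * (a * Φ (d τ z) + m * φ (d τ z))),
    Real.exp (c * τ) * (y ^ a / y ^ 2 * ((a - 1) * (a * Φ (d τ y) + m * φ (d τ y)) +
      (a * m * φ (d τ y) - m ^ 2 * d τ y * φ (d τ y)))), fun z hz => ?_, ?_, ?_⟩
  · have h := ((hasDerivAt_rpow_const_of_pos hz a).mul_const (Real.exp (c * τ))).mul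
      ((hΦ (d τ z)).comp z (hdz z hz))
    refine h.congr_deriv ?_
    simp only [Function.comp]
    field_simp
  · have h := (((hasDerivAt_rpow_const_of_pos hy a).div (hasDerivAt_id y) hy.ne').mul
      ((((hΦ (d τ y)).comp y (hdz y hy)).const_mul a).add
        (((hφ (d τ y)).comp y (hdz y hy)).const_mul m))).const_mul (Real.exp (c * τ))
    refine h.congr_deriv ?_
    simp only [Function.comp, id, Pi.add_apply, Pi.div_apply]
    field_simp
    ring
  · have h := ((((hasDerivAt_id τ).const_mul c).exp).const_mul (y ^ a)).mul
      ((hΦ (d τ y)).comp τ hdt)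
    refine h.congr_deriv ?_
    have hm2 : m ^ 2 = 1 / (θ ^ 2 * τ) := by rw [hm, div_pow, mul_pow, hs, hr2]
    simp only [Function.comp, id, hm2]
    rw [hc, hb]
    field_simp
    ring

/-- the closed-form dual value function solves the linear backward
Kolmogorov (dual HJB) equation ∂_τ G = −α y ∂_y G + (1/2) θ² y² ∂_yy G. -/
theorem dual_value_pde
    (p K α θ R zHat uHat u₀ q : ℝ)
    (hp : 0 < p) (hp1 : p < 1) (hK : 0 ≤ K) (hθ : 0 < θ) (hR : 0 < R) (hzHat : R < zHat)
    (htan : (zHat - R) ^ p + K * R ^ p = p * zHat * (zHat - R) ^ (p - 1))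
    (huHat : uHat = p * (zHat - R) ^ (p - 1))
    (hu₀ : u₀ = -(K * R ^ p))
    (hq : q = p / (p - 1))
    (Φ : ℝ → ℝ)
    (hΦ : ∀ x, Φ x = ∫ t in Iic x, (Real.sqrt (2 * Real.pi))⁻¹ * Real.exp (-(t ^ 2) / 2))
    (k : ℝ → ℝ → ℝ)
    (hk : ∀ τ y, k τ y =
      (Real.log y - Real.log uHat - (α + θ ^ 2 / 2) * τ) / (θ * Real.sqrt τ))
    (G : ℝ → ℝ → ℝ)
    (hG : ∀ τ y, G τ y =
      y ^ q * p ^ (-q) * (1 - p) * Real.exp (-q * (α - θ ^ 2 / (2 * (p - 1))) * τ) *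
          Φ (-(k τ y) - q * θ * Real.sqrt τ)
        - R * y * Real.exp (-α * τ) * Φ (-(k τ y) - θ * Real.sqrt τ)
        + u₀ * Φ (k τ y)) :
    ∀ τ > (0:ℝ), ∀ y > (0:ℝ),
      HasDerivAt (fun t => G t y)
        (-α * y * deriv (fun z => G τ z) y
          + (1 / 2) * θ ^ 2 * y ^ 2 * deriv (deriv (fun z => G τ z)) y) τ := by
  intro τ hτ y hy
  have hΦ' (x : ℝ) :
      HasDerivAt Φ ((Real.sqrt (2 * Real.pi))⁻¹ * Real.exp (-(x ^ 2) / 2)) x := by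
    rw [funext hΦ]
    exact hasDerivAt_gaussian_cdf _ x
  have hφ' := hasDerivAt_gaussian (Real.sqrt (2 * Real.pi))⁻¹
  have hsol (a : ℝ) {s : ℝ} (hs : s ^ 2 = 1) :=
    solvesKolmogorovAt_rpow_mul_exp_mul (α := α) hθ hτ hy hΦ' hφ' a (Real.log uHat) hs
  have hsum := (((hsol q (s := -1) (by norm_num)).const_mul (p ^ (-q) * (1 - p))).add
    ((hsol 1 (s := -1) (by norm_num)).const_mul (-R))).add
    ((hsol 0 (s := 1) (by norm_num)).const_mul u₀)
  have hrate : -q * (α - θ ^ 2 / (2 * (p - 1))) = -α * q + θ ^ 2 / 2 * (q * (q - 1)) := by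
    have : p - 1 ≠ 0 := by linarith
    rw [hq]
    field_simp
    ring
  have harg (a : ℝ) {t : ℝ} (ht : 0 < t) (z : ℝ) : -(k t z) - a * θ * Real.sqrt t =
      -1 * ((Real.log z - Real.log uHat - (α + θ ^ 2 / 2 - a * θ ^ 2) * t) /
        (θ * Real.sqrt t)) := by
    have hr : 0 < Real.sqrt t := Real.sqrt_pos.2 ht
    have hr2 : Real.sqrt t ^ 2 = t := Real.sq_sqrt ht.le
    rw [hk]
    field_simp
    rw [hr2]
    ring
  refine (hsum.congr hτ fun t ht => funext fun z => ?_).hasDerivAt hy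
  have h1 := harg 1 ht z
  rw [one_mul] at h1
  rw [hG, harg q ht, h1, hk, hrate]
  simp only [Real.rpow_one, Real.rpow_zero, mul_zero, zero_mul, mul_one, sub_self, add_zero,
    sub_zero, Real.exp_zero, one_mul]
  ring
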